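/- There is a universal constant C > 0 such that for every ε > 0, β ∈ (0,1), and integers d, T ≥ 1, there exists an ε-differentially private (event level) continual-observation mechanism M with input universe {0,1}^d, output space ℝ and stream length T such that for every input stream x, with M(x)-probability at least 1 − β, the output sequence (a^1,…,a^T) satisfies |a^t − min_{i ≤ d} h^t(x)_i| ≤ C · ε^{-1} · ( d·log²(d·n_min(x)/β) + log T ) for all t ≤ T, where n_min(x) = min_{i ≤ d} h^T(x)_i is the minimum column sum of x (the MinSum problem under continual observation). -/

import Mathlib

open MeasureTheory

/-- Base-2 logarithm where the argument is clamped below by 2. -/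
noncomputable def log2c (z : ℝ) : ℝ := Real.logb 2 (max z 2)

/-- The histogram of a stream of rows from `{0,1}^d` at time step `t`:
the `i`-th column sum of the first `t+1` rows (time steps are 0-indexed). -/
def hist {d T : ℕ} (x : Fin T → Fin d → Bool) (t : Fin T) (i : Fin d) : ℕ :=
  ∑ s : Fin T, if s ≤ t ∧ x s i then 1 else 0

/-- Two streams differ in at most one time step (event-level neighboring). -/
def EventNeighboring {X : Type*} {T : ℕ} (x y : Fin T → X) : Prop :=
  ∃ t₀ : Fin T, ∀ s : Fin T, s ≠ t₀ → x s = y s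

/-- A continual-observation mechanism: a measurable assignment of output
distributions to input streams whose outputs up to time `t` depend only on the
first `t` inputs. -/
def IsCOMech {X O : Type*} [MeasurableSpace X] [MeasurableSpace O] {T : ℕ}
    (M : (Fin T → X) → Measure (Fin T → O)) : Prop :=
  Measurable M ∧ (∀ x, IsProbabilityMeasure (M x)) ∧
    ∀ (t : Fin T) (x y : Fin T → X), (∀ s, s ≤ t → x s = y s) →
      (M x).map (fun a (s : {s : Fin T // s ≤ t}) => a s.1) =
      (M y).map (fun a (s : {s : Fin T // s ≤ t}) => a s.1)

/-- `ε`-differential privacy (event level) for a continual-observation mechanism. -/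
def IsEventDP {X O : Type*} [MeasurableSpace X] [MeasurableSpace O] {T : ℕ} (ε : ℝ)
    (M : (Fin T → X) → Measure (Fin T → O)) : Prop :=
  ∀ x y, EventNeighboring x y → ∀ S : Set (Fin T → O), MeasurableSet S →
    M x S ≤ ENNReal.ofReal (Real.exp ε) * M y S

/-- The last (0-indexed) time step of a stream of length `T ≥ 1`. -/
def lastIdx (T : ℕ) (hT : 1 ≤ T) : Fin T := ⟨T - 1, Nat.sub_lt hT Nat.one_pos⟩

/-- The minimum column sum of the histogram at time `t`. -/
noncomputable def minSum {d T : ℕ} (x : Fin T → Fin d → Bool) (t : Fin T) : ℕ :=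
  sInf (Set.range fun i : Fin d => hist x t i)


def par : ℕ → ℕ
  | 0 => 0
  | 1 => 0
  | 2 => 1
  | (n+3) => if (n+3) % 2 = 1 then n+2 else 2 * par ((n+3)/2)
decreasing_by omega

theorem par_odd (m : ℕ) (hm : 1 ≤ m) : par (2*m+1) = 2*m := by
  obtain ⟨k, rfl⟩ : ∃ k, m = k+1 := ⟨m-1, by omega⟩
  have : 2*(k+1)+1 = (2*k)+3 := by ring
  rw [this, par, if_pos (by omega)]; omega

theorem par_even (m : ℕ) (hm : 2 ≤ m) : par (2*m) = 2*par m := by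
  obtain ⟨k, rfl⟩ : ∃ k, m = k+2 := ⟨m-2, by omega⟩
  have : 2*(k+2) = (2*k+1)+3 := by ring
  rw [this, par, if_neg (by omega)]
  congr 2; omega

theorem par_lt (n : ℕ) (hn : n ≠ 0) : par n < n := by
  induction n using Nat.strong_induction_on with
  | _ n ih =>
    obtain ⟨m, hm | hm⟩ : ∃ m, n = 2*m ∨ n = 2*m+1 := ⟨n/2, by omega⟩
    · by_cases h2 : 2 ≤ m
      · rw [hm, par_even m h2]
        have := ih m (by omega) (by omega); omega
      · have : n = 2 := by omega
        subst this; simp [par]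
    · by_cases h2 : 1 ≤ m
      · rw [hm, par_odd m h2]; omega
      · have : n = 1 := by omega
        subst this; simp [par]

theorem par_pos (n : ℕ) (hn : 2 ≤ n) : 1 ≤ par n := by
  induction n using Nat.strong_induction_on with
  | _ n ih =>
    obtain ⟨m, hm | hm⟩ : ∃ m, n = 2*m ∨ n = 2*m+1 := ⟨n/2, by omega⟩
    · by_cases h2 : 2 ≤ m
      · rw [hm, par_even m h2]
        have := ih m (by omega) (by omega); omega
      · have : n = 2 := by omega
        subst this; simp [par]
    · rw [hm, par_odd m (by omega)]; omega

def ell (k : ℕ) : ℕ := Nat.clog 2 k + 1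

theorem ell_step (n : ℕ) (hn : 2 ≤ n) : ell n = ell ((n+1)/2) + 1 := by
  unfold ell
  rw [Nat.clog_of_two_le (by norm_num) hn]
  rfl

theorem ell_mono {a b : ℕ} (h : a ≤ b) : ell a ≤ ell b :=
  Nat.add_le_add_right (Nat.clog_mono_right 2 h) 1

theorem cover_card (n i : ℕ) (hi : 1 ≤ i) :
    ((Finset.range n).filter (fun k => par k < i ∧ i ≤ k)).card ≤ ell i := by
  induction i using Nat.strong_induction_on with
  | _ i ih =>
    by_cases h1 : i = 1
    · subst h1
      have : (Finset.range n).filter (fun k => par k < 1 ∧ 1 ≤ k) ⊆ {1} := by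
        intro k hk
        simp only [Finset.mem_filter, Finset.mem_singleton] at hk ⊢
        by_contra hne
        have := par_pos k (by omega)
        omega
      have := Finset.card_le_card this
      simp [ell] at this ⊢
      exact this
    · rw [ell_step i (by omega)]
      have hsub : (Finset.range n).filter (fun k => par k < i ∧ i ≤ k) ⊆
          insert i (((Finset.range n).filter
            (fun k => par k < (i+1)/2 ∧ (i+1)/2 ≤ k)).image (fun m => 2*m)) := by
        intro k hk
        simp only [Finset.mem_filter, Finset.mem_insert, Finset.mem_image, Finset.mem_range] at hk ⊢
        obtain ⟨hkn, hk1, hk2⟩ := hk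
        obtain ⟨m, hm | hm⟩ : ∃ m, k = 2*m ∨ k = 2*m+1 := ⟨k/2, by omega⟩
        · right
          refine ⟨m, ⟨by omega, ?_, by omega⟩, hm.symm⟩
          by_cases h2 : 2 ≤ m
          · rw [hm, par_even m h2] at hk1; omega
          · have : m = 1 := by omega
            subst this
            have : par 1 = 0 := by simp [par]
            omega
        · left
          rw [hm, par_odd m (by omega)] at hk1; omega
      refine (Finset.card_le_card hsub).trans ((Finset.card_insert_le _ _).trans ?_)
      have := ih ((i+1)/2) (by omega) (by omega)
      have h3 := Finset.card_image_le (s := (Finset.range n).filter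
            (fun k => par k < (i+1)/2 ∧ (i+1)/2 ≤ k)) (f := fun m => 2*m)
      omega

def chain (n : ℕ) : Finset ℕ :=
  if h : n = 0 then ∅ else insert n (chain (par n))
termination_by n
decreasing_by exact par_lt n h

theorem chain_zero : chain 0 = ∅ := by rw [chain]; simp
theorem chain_ne (n : ℕ) (h : n ≠ 0) : chain n = insert n (chain (par n)) := by
  rw [chain]; simp [h]

theorem chain_mem (n k : ℕ) (h : k ∈ chain n) : 1 ≤ k ∧ k ≤ n := by
  induction n using Nat.strong_induction_on with
  | _ n ih =>
    by_cases h0 : n = 0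
    · subst h0; simp [chain_zero] at h
    · rw [chain_ne n h0, Finset.mem_insert] at h
      rcases h with h | h
      · omega
      · have := ih _ (par_lt n h0) h
        have := par_lt n h0
        omega

theorem chain_sum {A : Type*} [AddCommMonoid A] (z : ℕ → A) (n : ℕ) (h0 : n ≠ 0) :
    ∑ k ∈ chain n, z k = z n + ∑ k ∈ chain (par n), z k := by
  rw [chain_ne n h0, Finset.sum_insert]
  intro h
  have := chain_mem _ _ h
  have := par_lt n h0
  omega

theorem chain_card_even (m : ℕ) (hm : 1 ≤ m) : (chain (2*m)).card ≤ (chain m).card + 1 := by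
  induction m using Nat.strong_induction_on with
  | _ m ih =>
    by_cases h2 : 2 ≤ m
    · rw [chain_ne (2*m) (by omega), chain_ne m (by omega), par_even m h2]
      refine (Finset.card_insert_le _ _).trans ?_
      have := ih (par m) (par_lt m (by omega)) (par_pos m h2)
      rw [Finset.card_insert_of_notMem]
      · omega
      · intro h
        have := chain_mem _ _ h
        have := par_lt m (by omega)
        omega
    · have : m = 1 := by omega
      subst this
      rw [chain_ne 2 (by omega)]
      have : par 2 = 1 := by simp [par]
      rw [this]
      exact Finset.card_insert_le _ _

theorem chain_card (n : ℕ) : (chain n).card ≤ 2 * ell n := by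
  induction n using Nat.strong_induction_on with
  | _ n ih =>
    by_cases h0 : n = 0
    · subst h0; simp [chain_zero]
    by_cases h1 : n = 1
    · subst h1
      rw [chain_ne 1 (by omega)]
      have : par 1 = 0 := by simp [par]
      rw [this, chain_zero]; simp [ell]
    rw [ell_step n (by omega)]
    obtain ⟨m, hm | hm⟩ : ∃ m, n = 2*m ∨ n = 2*m+1 := ⟨n/2, by omega⟩
    · have h1 := chain_card_even m (by omega)
      have h2 := ih m (by omega)
      have h3 : ell m ≤ ell ((n+1)/2) := ell_mono (by omega)
      rw [hm] at h3 ⊢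
      omega
    · have h1 := chain_card_even m (by omega)
      have h2 := ih m (by omega)
      have h3 : ell m ≤ ell ((n+1)/2) := ell_mono (by omega)
      have h4 : (chain n).card ≤ (chain (2*m)).card + 1 := by
        rw [chain_ne n h0, hm, par_odd m (by omega)]
        exact Finset.card_insert_le _ _
      omega

theorem chain_cover (J i : ℕ) (hi : 1 ≤ i) (δ : ℤ) :
    ∑ k ∈ chain J, (if par k < i ∧ i ≤ k then δ else 0) = if i ≤ J then δ else 0 := by
  induction J using Nat.strong_induction_on with
  | _ J ih =>
    by_cases h0 : J = 0
    · subst h0; simp [chain_zero]; omega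
    · rw [chain_sum _ _ h0, ih _ (par_lt J h0)]
      have := par_lt J h0
      split_ifs <;> omega

/-! minimum -/
noncomputable def mn {d : ℕ} (f : Fin d → ℤ) : ℤ := ⨅ i, f i

theorem mn_le {d : ℕ} (f : Fin d → ℤ) (i : Fin d) : mn f ≤ f i :=
  ciInf_le (Set.finite_range f).bddBelow i

theorem mn_mem {d : ℕ} (hd : 1 ≤ d) (f : Fin d → ℤ) : ∃ i, f i = mn f := by
  have : Nonempty (Fin d) := ⟨⟨0, hd⟩⟩
  exact exists_eq_ciInf_of_finite

theorem mn_lip {d : ℕ} (hd : 1 ≤ d) (f g : Fin d → ℤ) (e : ℝ)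
    (h : ∀ i, ((f i : ℤ) : ℝ) ≤ g i + e) : ((mn f : ℤ) : ℝ) ≤ mn g + e := by
  obtain ⟨i, hi⟩ := mn_mem hd g
  have h1 : ((mn f : ℤ) : ℝ) ≤ (f i : ℤ) := by exact_mod_cast mn_le f i
  have := h i
  rw [hi] at this
  linarith

def HH {d T : ℕ} (x : Fin T → Fin d → Bool) (t : ℕ) (i : Fin d) : ℤ :=
  ∑ s : Fin T, if s.val ≤ t ∧ x s i then 1 else 0

/-- one step of the mechanism -/
noncomputable def stp {d : ℕ} (K : ℕ → ℝ) (h : Fin d → ℤ) (r : ℕ → ℤ) (v : ℤ)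
    (Z : ℕ → Fin d → ℤ) (s : ℕ × ℤ) : ℕ × ℤ :=
  open Classical in
  if (s.2 : ℝ) + K s.1 + r s.1 ≤ (mn (fun i => h i + ∑ k ∈ chain s.1, Z k i) : ℤ) + v then
    (s.1 + 1, mn (fun i => h i + ∑ k ∈ chain (s.1+1), Z k i))
  else s

noncomputable def run {d : ℕ} (K : ℕ → ℝ) (h : ℕ → Fin d → ℤ) (r : ℕ → ℤ) (v : ℕ → ℤ)
    (Z : ℕ → Fin d → ℤ) : ℕ → ℕ × ℤ
  | 0 => (0, 0)
  | (t+1) => stp K (h t) r (v t) Z (run K h r v Z t)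

section
variable {d : ℕ} (K : ℕ → ℝ) (h : ℕ → Fin d → ℤ) (r : ℕ → ℤ) (v : ℕ → ℤ)
    (Z : ℕ → Fin d → ℤ)

theorem run_le (t : ℕ) : (run K h r v Z t).1 ≤ t := by
  induction t with
  | zero => simp [run]
  | succ t ih => rw [run, stp]; split_ifs <;> (try simp) <;> omega

theorem run_mono : Monotone (fun t => (run K h r v Z t).1) := by
  refine monotone_nat_of_le_succ (fun t => ?_)
  rw [run, stp]; split_ifs
  · exact Nat.le_succ _
  · exact le_rfl

theorem run_causal (h' : ℕ → Fin d → ℤ) (t : ℕ) (hh : ∀ s < t, h s = h' s) :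
    run K h r v Z t = run K h' r v Z t := by
  induction t with
  | zero => rfl
  | succ t ih => rw [run, run, hh t (by omega), ih (fun s hs => hh s (by omega))]

/-- the coupling -/
theorem run_couple (hd : 1 ≤ d) (T t0 : ℕ) (h' : ℕ → Fin d → ℤ) (r' v' : ℕ → ℤ) (Z' : ℕ → Fin d → ℤ)
    (δ : Fin d → ℤ) (hδ : ∀ i, |δ i| ≤ 1)
    (hh : ∀ t i, h' t i = h t i - if t0 ≤ t then δ i else 0)
    (hr : ∀ j ≤ T, r' j = r j + if j = (run K h r v Z t0).1 then 1 else 0)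
    (hv : ∀ t < T, v' t = v t + if (run K h r v Z t).1 = (run K h r v Z t0).1 ∧
      (run K h r v Z (t+1)).1 ≠ (run K h r v Z t0).1 then 2 else 0)
    (hZ : ∀ k ≤ T, ∀ i, Z' k i = Z k i +
      if par k < (run K h r v Z t0).1 + 1 ∧ (run K h r v Z t0).1 + 1 ≤ k then δ i else 0)
    (t : ℕ) (ht : t ≤ T) : run K h' r' v' Z' t = run K h r v Z t := by
  have hN : ∀ J ≤ T, ∀ i, ∑ k ∈ chain J, Z' k i = ∑ k ∈ chain J, Z k i +
      if (run K h r v Z t0).1 + 1 ≤ J then δ i else 0 := by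
    intro J hJ i
    rw [← chain_cover J _ (by omega), ← Finset.sum_add_distrib]
    refine Finset.sum_congr rfl (fun k hk => ?_)
    exact hZ k ((chain_mem _ _ hk).2.trans hJ) i
  have hmono := run_mono K h r v Z
  induction t with
  | zero => rfl
  | succ t ih =>
    have hle := run_le K h r v Z t
    have hmt : t ≤ t0 → (run K h r v Z t).1 ≤ (run K h r v Z t0).1 := fun hh => hmono hh
    have hmt' : t0 ≤ t → (run K h r v Z t0).1 ≤ (run K h r v Z t).1 := fun hh => hmono hh
    have hmt2 : t+1 ≤ t0 → (run K h r v Z (t+1)).1 ≤ (run K h r v Z t0).1 := fun hh => hmono hh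
    have hvt := hv t (by omega)
    have hsx : run K h r v Z (t+1) = stp K (h t) r (v t) Z (run K h r v Z t) := rfl
    rw [run, ih (by omega)]
    generalize hjs : (run K h r v Z t0).1 = js at *
    generalize hst : run K h r v Z t = st at *
    have hrt := hr st.1 (by omega)
    have e1 := hN st.1 (by omega)
    have e2 := hN (st.1+1) (by omega)
    rw [hsx]
    rw [hsx] at hvt hmt2
    rcases lt_trichotomy st.1 js with hlt | heq | hgt
    · have ht0 : ¬ t0 ≤ t := by omega
      have hv0 : v' t = v t := by rw [hvt, if_neg (by omega)]; simp
      have hr0 : r' st.1 = r st.1 := by rw [hrt, if_neg (by omega)]; simp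
      simp only [stp, hv0, hr0, e1, e2, hh, if_neg ht0, if_neg (show ¬ js + 1 ≤ st.1 by omega),
        if_neg (show ¬ js + 1 ≤ st.1 + 1 by omega), sub_zero, add_zero]
    · have hr0 : r' st.1 = r st.1 + 1 := by rw [hrt, if_pos heq]
      have hq1 : (mn (fun i => h' t i + ∑ k ∈ chain st.1, Z' k i) : ℝ) ≤
          mn (fun i => h t i + ∑ k ∈ chain st.1, Z k i) + 1 := by
        apply mn_lip hd
        intro i
        have := abs_le.1 (hδ i)
        rw [e1, if_neg (show ¬ js + 1 ≤ st.1 by omega), hh]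
        have : h t i - (if t0 ≤ t then δ i else 0) ≤ h t i + 1 := by split_ifs <;> omega
        have : ((h t i - (if t0 ≤ t then δ i else 0) : ℤ):ℝ) ≤ h t i + 1 := by exact_mod_cast this
        push_cast at this ⊢
        linarith
      have hq2 : (mn (fun i => h t i + ∑ k ∈ chain st.1, Z k i) : ℝ) ≤
          mn (fun i => h' t i + ∑ k ∈ chain st.1, Z' k i) + 1 := by
        apply mn_lip hd
        intro i
        have := abs_le.1 (hδ i)
        rw [e1, if_neg (show ¬ js + 1 ≤ st.1 by omega), hh]
        have : h t i ≤ h t i - (if t0 ≤ t then δ i else 0) + 1 := by split_ifs <;> omega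
        have : (h t i : ℝ) ≤ ((h t i - (if t0 ≤ t then δ i else 0) : ℤ):ℝ) + 1 := by exact_mod_cast this
        push_cast at this ⊢
        linarith
      by_cases hc : (st.2 : ℝ) + K st.1 + r st.1 ≤
          (mn (fun i => h t i + ∑ k ∈ chain st.1, Z k i) : ℤ) + v t
      · have hs : stp K (h t) r (v t) Z st =
            (st.1 + 1, mn (fun i => h t i + ∑ k ∈ chain (st.1+1), Z k i)) := by
          rw [stp, if_pos hc]
        rw [hs] at hvt hmt2 ⊢
        have ht0 : t0 ≤ t := by
          by_contra hcon
          have := hmt2 (by omega)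
          simp at this; omega
        have hv0 : v' t = v t + 2 := by
          rw [hvt, if_pos]; simp; omega
        rw [stp, if_pos]
        · congr 2
          funext i
          rw [e2, hh, if_pos ht0, if_pos (by omega)]
          ring
        · rw [hv0, hr0]; push_cast; linarith
      · have hs : stp K (h t) r (v t) Z st = st := by
          rw [stp, if_neg hc]
        rw [hs] at hvt hmt2 ⊢
        have hv0 : v' t = v t := by
          rw [hvt, if_neg]; simp; omega
        rw [stp, if_neg]
        rw [hv0, hr0]; push_cast; linarith
    · have ht0 : t0 ≤ t := by omega
      have hv0 : v' t = v t := by rw [hvt, if_neg (by omega)]; simp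
      have hr0 : r' st.1 = r st.1 := by rw [hrt, if_neg (by omega)]; simp
      have e3 : ∀ i, h t i - δ i + (∑ k ∈ chain st.1, Z k i + δ i) =
        h t i + ∑ k ∈ chain st.1, Z k i := fun i => by ring
      have e4 : ∀ i, h t i - δ i + (∑ k ∈ chain (st.1+1), Z k i + δ i) =
        h t i + ∑ k ∈ chain (st.1+1), Z k i := fun i => by ring
      simp only [stp, hv0, hr0, e1, e2, hh, if_pos ht0, if_pos (show js + 1 ≤ st.1 by omega),
        if_pos (show js + 1 ≤ st.1 + 1 by omega), e3, e4]

/-- accuracy -/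
theorem run_acc (hd : 1 ≤ d) (T : ℕ) (E : ℕ → ℝ) (R : ℝ) (hR : 0 < R) (hE : ∀ j, 0 ≤ E j)
    (hK : ∀ j, K j = 3 * E j + 3 * R)
    (h0 : ∀ i, 0 ≤ h 0 i) (hm : ∀ i, Monotone (fun t => h t i))
    (hr : ∀ j ≤ T, |(r j : ℝ)| ≤ R) (hv : ∀ t ≤ T, |(v t : ℝ)| ≤ R)
    (hZ : ∀ J ≤ T, ∀ i, |((∑ k ∈ chain J, Z k i : ℤ) : ℝ)| ≤ E J)
    (t : ℕ) (ht : t < T) :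
    ((run K h r v Z (t+1)).1 : ℤ) ≤ mn (h t) ∧
    ((run K h r v Z (t+1)).1 = 0 → (run K h r v Z (t+1)).2 = 0) ∧
    |((run K h r v Z (t+1)).2 : ℝ) - mn (h t)| ≤
      4 * E (run K h r v Z (t+1)).1 + 5 * R := by
  have hq : ∀ J ≤ T, ∀ t, (mn (fun i => h t i + ∑ k ∈ chain J, Z k i) : ℝ) ≤ mn (h t) + E J ∧
      (mn (h t) : ℝ) ≤ mn (fun i => h t i + ∑ k ∈ chain J, Z k i) + E J := by
    intro J hJ t
    constructor
    · apply mn_lip hd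
      intro i
      have := abs_le.1 (hZ J hJ i)
      push_cast at this ⊢
      linarith
    · apply mn_lip hd
      intro i
      have := abs_le.1 (hZ J hJ i)
      push_cast at this ⊢
      linarith
  have key : ∀ t < T, ∀ st : ℕ × ℤ, st.1 ≤ t → ∀ m0 : ℤ, m0 ≤ mn (h t) → (st.1 : ℤ) ≤ m0 →
      |(st.2 : ℝ) - m0| ≤ E st.1 → (st.1 = 0 → st.2 = 0) →
      ∃ m1 : ℤ, m1 ≤ mn (h t) ∧ ((stp K (h t) r (v t) Z st).1 : ℤ) ≤ m1 ∧
       |((stp K (h t) r (v t) Z st).2 : ℝ) - m1| ≤ E (stp K (h t) r (v t) Z st).1 ∧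
       ((stp K (h t) r (v t) Z st).1 = 0 → (stp K (h t) r (v t) Z st).2 = 0) ∧
       (mn (h t) : ℝ) - (stp K (h t) r (v t) Z st).2 ≤
        4 * E (stp K (h t) r (v t) Z st).1 + 5 * R := by
    intro t ht st hst m0 hm0 hj ha hz
    have h1 := hq st.1 (by omega) t
    have h2 := hq (st.1+1) (by omega) t
    have h3 := abs_le.1 (hr st.1 (by omega))
    have h4 := abs_le.1 (hv t (by omega))
    have h5 := abs_le.1 ha
    have h6 := hK st.1
    by_cases hc : (st.2 : ℝ) + K st.1 + r st.1 ≤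
          (mn (fun i => h t i + ∑ k ∈ chain st.1, Z k i) : ℤ) + v t
    · have hs : stp K (h t) r (v t) Z st =
            (st.1 + 1, mn (fun i => h t i + ∑ k ∈ chain (st.1+1), Z k i)) := by
          rw [stp, if_pos hc]
      rw [hs]
      refine ⟨mn (h t), le_rfl, ?_, ?_, by simp, ?_⟩
      · have : (m0 : ℝ) < mn (h t) := by
          have := hE st.1
          linarith
        have : m0 < mn (h t) := by exact_mod_cast this
        push_cast; omega
      · rw [abs_le]; constructor <;> dsimp only <;> linarith
      · dsimp only
        have := hE (st.1+1)
        linarith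
    · have hs : stp K (h t) r (v t) Z st = st := by
          rw [stp, if_neg hc]
      rw [hs]
      refine ⟨m0, hm0, hj, ha, hz, ?_⟩
      linarith
  have hmm : ∀ s t, s ≤ t → mn (h s) ≤ mn (h t) := by
    intro s t hst
    obtain ⟨i, hi⟩ := mn_mem hd (h t)
    rw [← hi]
    exact (mn_le _ i).trans (hm i hst)
  have inv : ∀ t < T, ∃ m1 : ℤ, m1 ≤ mn (h t) ∧ ((run K h r v Z (t+1)).1 : ℤ) ≤ m1 ∧
       |((run K h r v Z (t+1)).2 : ℝ) - m1| ≤ E (run K h r v Z (t+1)).1 ∧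
       ((run K h r v Z (t+1)).1 = 0 → (run K h r v Z (t+1)).2 = 0) ∧
       (mn (h t) : ℝ) - (run K h r v Z (t+1)).2 ≤
        4 * E (run K h r v Z (t+1)).1 + 5 * R := by
    intro t
    induction t with
    | zero =>
      intro ht
      refine key 0 ht (run K h r v Z 0) (by simp [run]) 0 ?_ (by simp [run]) ?_ (by simp [run])
      · obtain ⟨i, hi⟩ := mn_mem hd (h 0)
        rw [← hi]; exact h0 i
      · simp [run]; exact hE 0
    | succ t ih =>
      intro ht
      obtain ⟨m1, a1, a2, a3, a4, a5⟩ := ih (by omega)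
      exact key (t+1) ht (run K h r v Z (t+1)) (run_le ..) m1 (a1.trans (hmm _ _ (by omega))) a2 a3 a4
  obtain ⟨m1, a1, a2, a3, a4, a5⟩ := inv t ht
  refine ⟨a2.trans a1, a4, ?_⟩
  have h5 := abs_le.1 a3
  have : (m1 : ℝ) ≤ mn (h t) := by exact_mod_cast a1
  have := hE (run K h r v Z (t+1)).1
  rw [abs_le]; constructor <;> linarith
end

theorem hasSum_lap (a : ℝ) (ha : 0 < a) :
    HasSum (fun k : ℤ => Real.exp (-a * |(k:ℝ)|))
      ((1 + Real.exp (-a)) / (1 - Real.exp (-a))) := by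
  have hq0 := Real.exp_pos (-a)
  have hq1 : Real.exp (-a) < 1 := by rw [Real.exp_lt_one_iff]; linarith
  have hg := hasSum_geometric_of_lt_one hq0.le hq1
  have h := HasSum.of_nat_of_neg_add_one (f := fun k : ℤ => Real.exp (-a * |(k:ℝ)|))
    (m := (1 - Real.exp (-a))⁻¹) (m' := Real.exp (-a) * (1 - Real.exp (-a))⁻¹) ?_ ?_
  · convert h using 1
    have : 1 - Real.exp (-a) ≠ 0 := by linarith
    field_simp
  · have e : ∀ n : ℕ, Real.exp (-a * |(((n : ℕ) : ℤ) : ℝ)|) = Real.exp (-a) ^ n := by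
      intro n
      rw [← Real.exp_nat_mul]
      congr 1
      simp; ring
    simpa only [e] using hg
  · have e : ∀ n : ℕ, Real.exp (-a * |(((-((n:ℤ)+1)) : ℤ) : ℝ)|) =
        Real.exp (-a) * Real.exp (-a) ^ n := by
      intro n
      rw [← Real.exp_nat_mul, ← Real.exp_add]
      congr 1
      have : |(((-((n:ℤ)+1)) : ℤ) : ℝ)| = n + 1 := by
        push_cast
        rw [abs_of_nonpos (by linarith [Nat.cast_nonneg (α := ℝ) n])]; ring
      rw [this]; ring
    simpa only [e] using hg.mul_left (Real.exp (-a))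

theorem exists_lap (a : ℝ) (ha : 0 < a) : ∃ p : Measure ℤ, IsProbabilityMeasure p ∧
    (∀ n m : ℤ, p {n} ≤ ENNReal.ofReal (Real.exp (a * |(m:ℝ)|)) * p {n + m}) ∧
    ∫⁻ k, ENNReal.ofReal (Real.exp (a / 2 * |(k:ℝ)|)) ∂p ≤ 2 := by
  set f : ℤ → ENNReal := fun k => ENNReal.ofReal (Real.exp (-a * |(k:ℝ)|)) with hf
  have hs := hasSum_lap a ha
  have hs2 := hasSum_lap (a/2) (by linarith)
  set q := Real.exp (-(a/2)) with hq
  have hq0 : 0 < q := Real.exp_pos _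
  have hq1 : q < 1 := by rw [hq, Real.exp_lt_one_iff]; linarith
  have hqq : Real.exp (-a) = q^2 := by rw [hq, ← Real.exp_nat_mul]; congr 1; push_cast; ring
  rw [hqq] at hs
  have hZ : ∑' k, f k = ENNReal.ofReal ((1 + q^2) / (1 - q^2)) := by
    rw [hf, ← ENNReal.ofReal_tsum_of_nonneg (fun _ => (Real.exp_pos _).le) hs.summable, hs.tsum_eq]
  have hZpos : 0 < (1 + q^2) / (1 - q^2) := by
    apply div_pos <;> nlinarith
  have h0 : tsum f ≠ 0 := by rw [hZ]; simpa using hZpos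
  have h1 : tsum f ≠ ⊤ := by rw [hZ]; simp
  have hp : ∀ n, (PMF.normalize f h0 h1).toMeasure {n} = f n * (∑' k, f k)⁻¹ := by
    intro n
    rw [PMF.toMeasure_apply_singleton _ _ (measurableSet_singleton n), PMF.normalize_apply]
  refine ⟨(PMF.normalize f h0 h1).toMeasure, inferInstance, ?_, ?_⟩
  · intro n m
    rw [hp, hp, ← mul_assoc]
    gcongr
    rw [hf]
    dsimp only
    rw [← ENNReal.ofReal_mul (Real.exp_pos _).le, ← Real.exp_add]
    apply ENNReal.ofReal_le_ofReal
    apply Real.exp_le_exp.2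
    push_cast
    have := abs_add_le (n:ℝ) m
    nlinarith
  · rw [lintegral_countable']
    have : ∀ k : ℤ, ENNReal.ofReal (Real.exp (a / 2 * |(k:ℝ)|)) *
        (PMF.normalize f h0 h1).toMeasure {k} =
        ENNReal.ofReal (Real.exp (-(a / 2) * |(k:ℝ)|)) * (∑' k, f k)⁻¹ := by
      intro k
      rw [hp, ← mul_assoc]
      congr 1
      rw [hf]
      dsimp only
      rw [← ENNReal.ofReal_mul (Real.exp_pos _).le, ← Real.exp_add]
      congr 2
      ring
    simp_rw [this]
    rw [ENNReal.tsum_mul_right,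
      ← ENNReal.ofReal_tsum_of_nonneg (fun _ => (Real.exp_pos _).le) hs2.summable, hs2.tsum_eq, hZ,
      ← ENNReal.ofReal_inv_of_pos hZpos, ← ENNReal.ofReal_mul (by apply div_nonneg <;> nlinarith)]
    rw [show (2:ENNReal) = ENNReal.ofReal 2 by simp]
    apply ENNReal.ofReal_le_ofReal
    rw [← div_eq_mul_inv, div_le_iff₀ hZpos, ← mul_div_assoc, div_le_div_iff₀ (by linarith) (by nlinarith)]
    nlinarith [mul_nonneg (sub_nonneg.2 hq1.le) (sq_nonneg (1-q))]

theorem exists_noise {ι : Type*} [Fintype ι] (a : ι → ℝ) (ha : ∀ i, 0 < a i) :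
    ∃ μ : Measure (ι → ℤ), IsProbabilityMeasure μ ∧
      (∀ ω v : ι → ℤ, μ {ω} ≤ ENNReal.ofReal (Real.exp (∑ i, a i * |(v i : ℝ)|)) * μ {ω + v}) ∧
      (∀ (s : Finset ι) (θ c : ℝ), 0 ≤ θ → (∀ i ∈ s, θ ≤ a i / 2) →
        μ {ω | c < ∑ i ∈ s, |(ω i : ℝ)|} ≤ ENNReal.ofReal (2 ^ s.card * Real.exp (-(θ * c)))) := by
  choose p hp1 hp2 hp3 using fun i => exists_lap (a i) (ha i)
  refine ⟨Measure.pi p, inferInstance, ?_, ?_⟩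
  · intro ω v
    rw [Measure.pi_singleton, Measure.pi_singleton, Real.exp_sum,
      ENNReal.ofReal_prod_of_nonneg (fun _ _ => (Real.exp_pos _).le), ← Finset.prod_mul_distrib]
    exact Finset.prod_le_prod' (fun i _ => hp2 i _ _)
  · intro s θ c hθ hs
    set g : ι → (ι → ℤ) → ENNReal := fun i ω => ENNReal.ofReal (Real.exp (a i / 2 * |(ω i : ℝ)|)) with hg
    have hint : ∫⁻ ω, ∏ i ∈ s, g i ω ∂(Measure.pi p) ≤ 2 ^ s.card := by
      rw [ProbabilityTheory.lintegral_prod_eq_prod_lintegral_of_indepFun]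
      · rw [← Finset.prod_const]
        refine Finset.prod_le_prod' (fun i _ => ?_)
        refine le_trans (le_of_eq ?_) (hp3 i)
        have := (measurePreserving_eval p i).lintegral_comp
          (f := fun k : ℤ => ENNReal.ofReal (Real.exp (a i / 2 * |(k:ℝ)|))) (measurable_of_countable _)
        exact this
      · exact ProbabilityTheory.iIndepFun_pi
          (X := fun i (k : ℤ) => ENNReal.ofReal (Real.exp (a i / 2 * |(k:ℝ)|)))
          (fun i => (measurable_of_countable _).aemeasurable)
      · intro i; exact measurable_of_countable _
    have hsub : {ω : ι → ℤ | c < ∑ i ∈ s, |(ω i : ℝ)|} ⊆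
        {ω | ENNReal.ofReal (Real.exp (θ * c)) ≤ ∏ i ∈ s, g i ω} := by
      intro ω hω
      change c < _ at hω
      change ENNReal.ofReal (Real.exp (θ * c)) ≤ ∏ i ∈ s, g i ω
      rw [hg]
      dsimp only
      rw [← ENNReal.ofReal_prod_of_nonneg (fun _ _ => (Real.exp_pos _).le), ← Real.exp_sum]
      apply ENNReal.ofReal_le_ofReal
      apply Real.exp_le_exp.2
      calc θ * c ≤ θ * ∑ i ∈ s, |(ω i : ℝ)| := by gcongr
        _ = ∑ i ∈ s, θ * |(ω i : ℝ)| := Finset.mul_sum _ _ _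
        _ ≤ _ := Finset.sum_le_sum (fun i hi => mul_le_mul_of_nonneg_right (hs i hi) (abs_nonneg _))
    refine (measure_mono hsub).trans ((meas_ge_le_lintegral_div
      (measurable_of_countable _).aemeasurable (by simp [Real.exp_pos]) (by simp)).trans ?_)
    rw [ENNReal.ofReal_mul (by positivity), Real.exp_neg, ENNReal.ofReal_inv_of_pos (Real.exp_pos _),
      div_eq_mul_inv]
    gcongr
    refine hint.trans (le_of_eq ?_)
    rw [ENNReal.ofReal_pow (by norm_num)]; simp

/-- privacy from an injective coupling -/
theorem dp_of_coupling {Ω O : Type*} [MeasurableSpace Ω] [Countable Ω] [MeasurableSingletonClass Ω]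
    [MeasurableSpace O] (μ : Measure Ω) (F G : Ω → O) (φ : Ω → Ω) (hφ : Function.Injective φ)
    (hFG : ∀ ω, G (φ ω) = F ω) (c : ENNReal) (hc : ∀ ω, μ {ω} ≤ c * μ {φ ω})
    (S : Set O) (hS : MeasurableSet S) : μ.map F S ≤ c * μ.map G S := by
  rw [Measure.map_apply (measurable_of_countable _) hS, Measure.map_apply (measurable_of_countable _) hS,
    ← Measure.tsum_indicator_apply_singleton μ _ (Set.to_countable _).measurableSet,
    ← Measure.tsum_indicator_apply_singleton μ _ (Set.to_countable _).measurableSet,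
    ← ENNReal.tsum_mul_left]
  refine le_trans ?_ (ENNReal.tsum_comp_le_tsum_of_injective hφ _)
  refine ENNReal.tsum_le_tsum (fun ω => ?_)
  by_cases h : F ω ∈ S
  · rw [Set.indicator_of_mem (by exact h), Set.indicator_of_mem (by simpa [hFG] using h)]
    exact hc ω
  · rw [Set.indicator_of_notMem (by exact h)]
    exact zero_le
noncomputable def Eb (ε β : ℝ) (d J : ℕ) : ℝ :=
  4 * d * ell J / ε * Real.log (4 ^ (ell J) * (2 * d * (J+1) * (J+2) / β))

noncomputable def Rb (ε β : ℝ) (T : ℕ) : ℝ := 16 / ε * Real.log (16 * T / β)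

theorem Xb_ge (β : ℝ) (d J : ℕ) (hβ : β ∈ Set.Ioo (0:ℝ) 1) (hd : 1 ≤ d) :
    1 ≤ 4 ^ (ell J) * (2 * (d:ℝ) * (J+1) * (J+2) / β) := by
  have hd' : (1:ℝ) ≤ d := by exact_mod_cast hd
  have hJ : (0:ℝ) ≤ J := Nat.cast_nonneg _
  have h1 : (1:ℝ) ≤ 4 ^ (ell J) := one_le_pow₀ (by norm_num)
  have h2 : 1 ≤ 2 * (d:ℝ) * (J+1) * (J+2) / β := by
    rw [le_div_iff₀ hβ.1]
    have := hβ.2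
    have h3 : 1 ≤ ((J:ℝ)+1) * (J+2) := by nlinarith
    have : 1 ≤ (d:ℝ) * ((J+1) * (J+2)) := by nlinarith
    nlinarith
  nlinarith

theorem Eb_nonneg (ε β : ℝ) (d J : ℕ) (hε : 0 < ε) (hβ : β ∈ Set.Ioo (0:ℝ) 1) (hd : 1 ≤ d) :
    0 ≤ Eb ε β d J :=
  mul_nonneg (by positivity) (Real.log_nonneg (Xb_ge β d J hβ hd))

theorem Rb_pos (ε β : ℝ) (T : ℕ) (hε : 0 < ε) (hβ : β ∈ Set.Ioo (0:ℝ) 1) (hT : 1 ≤ T) :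
    0 < Rb ε β T := by
  have hT' : (1:ℝ) ≤ T := by exact_mod_cast hT
  refine mul_pos (by positivity) (Real.log_pos ?_)
  rw [lt_div_iff₀ hβ.1]
  have := hβ.2
  linarith

theorem log2c_ge_one (z : ℝ) : 1 ≤ log2c z := by
  unfold log2c
  rw [Real.le_logb_iff_rpow_le (by norm_num) (by positivity)]
  simp

theorem log_le_log2c (z : ℝ) (hz : 0 < z) : Real.log z ≤ log2c z := by
  have h1 : Real.log z ≤ Real.log (max z 2) := Real.log_le_log hz (le_max_left _ _)
  have h0 : 0 ≤ Real.log (max z 2) := Real.log_nonneg (le_trans (by norm_num) (le_max_right _ _))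
  unfold log2c Real.logb
  have hl2 : Real.log 2 ≤ 1 := by linarith [Real.log_two_lt_d9]
  have hl2' : 0 < Real.log 2 := Real.log_pos (by norm_num)
  rw [le_div_iff₀ hl2']
  nlinarith

theorem ell_le (n : ℕ) (z : ℝ) (hn : 1 ≤ n) (hz : (n:ℝ) ≤ z) : (ell n : ℝ) ≤ 3 * log2c z := by
  have h1 := log2c_ge_one z
  by_cases h : n = 1
  · subst h; simp [ell]; linarith
  · have h2 : 2 ^ (Nat.clog 2 n).pred < n := Nat.pow_pred_clog_lt_self (by norm_num) (by omega)
    have h3 : ((Nat.clog 2 n).pred : ℝ) ≤ log2c z := by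
      unfold log2c
      rw [Real.le_logb_iff_rpow_le (by norm_num) (by positivity), Real.rpow_natCast]
      refine le_trans ?_ (le_max_left _ _)
      refine le_trans ?_ hz
      exact_mod_cast h2.le
    have h4 : ell n ≤ (Nat.clog 2 n).pred + 2 := by
      unfold ell; rw [Nat.pred_eq_sub_one]; omega
    have : (ell n : ℝ) ≤ (Nat.clog 2 n).pred + 2 := by exact_mod_cast h4
    linarith

theorem final_bound (ε β : ℝ) (d T n J : ℕ) (hε : 0 < ε) (hβ : β ∈ Set.Ioo (0:ℝ) 1) (hd : 1 ≤ d)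
    (hT : 1 ≤ T) (hn : 1 ≤ n) (hJ : J ≤ n) :
    4 * Eb ε β d J + 5 * Rb ε β T ≤
      1000 * ε⁻¹ * ((d:ℝ) * (log2c ((d:ℝ) * (n:ℝ) / β)) ^ 2 + log2c (T:ℝ)) := by
  obtain ⟨hβ0, hβ1⟩ := hβ
  have hd' : (1:ℝ) ≤ d := by exact_mod_cast hd
  have hn' : (1:ℝ) ≤ n := by exact_mod_cast hn
  have hT' : (1:ℝ) ≤ T := by exact_mod_cast hT
  have hJ' : (J:ℝ) ≤ n := by exact_mod_cast hJ
  have hJ0 : (0:ℝ) ≤ J := Nat.cast_nonneg _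
  set z := (d:ℝ) * (n:ℝ) / β with hz
  have hz0 : 0 < z := by positivity
  have hnz : (n:ℝ) ≤ z := by
    rw [hz, le_div_iff₀ hβ0]; nlinarith
  have hbz : 1/β ≤ z := by
    rw [hz]; gcongr; nlinarith
  have hL1 := log2c_ge_one z
  have hLT := log2c_ge_one (T:ℝ)
  have hLz := log_le_log2c z hz0
  set L := log2c z with hL
  have hell : (ell J : ℝ) ≤ 3 * L := by
    have h1 : (ell J : ℝ) ≤ ell n := by exact_mod_cast ell_mono hJ
    exact h1.trans (ell_le n z hn hnz)
  have hell0 : (0:ℝ) ≤ ell J := Nat.cast_nonneg _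
  have hl2 : Real.log 2 ≤ 0.7 := by linarith [Real.log_two_lt_d9]
  have hl4 : Real.log 4 ≤ 1.4 := by
    rw [show (4:ℝ) = 2^2 by norm_num, Real.log_pow]; push_cast; linarith
  have hl16 : Real.log 16 ≤ 2.8 := by
    rw [show (16:ℝ) = 2^4 by norm_num, Real.log_pow]; push_cast; linarith
  have hX : Real.log (4 ^ (ell J) * (2 * (d:ℝ) * (J+1) * (J+2) / β)) ≤ 11 * L := by
    rw [Real.log_mul (by positivity) (by positivity), Real.log_pow]
    have h1 : Real.log (2 * (d:ℝ) * (J+1) * (J+2) / β) ≤ Real.log (16 * (z * z)) := by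
      apply Real.log_le_log (by positivity)
      have h2 : 2 * (d:ℝ) * (J+1) * (J+2) / β ≤ 12 * z * n := by
        rw [hz, div_le_iff₀ hβ0]
        have : 12 * ((d:ℝ) * n / β) * n * β = 2 * d * (2 * n) * (3 * n) := by field_simp; ring
        rw [this]
        gcongr <;> linarith
      have h3 : 12 * z * n ≤ 16 * (z*z) := by nlinarith
      linarith
    rw [Real.log_mul (by norm_num) (by positivity), Real.log_mul hz0.ne' hz0.ne'] at h1
    have h4 : (ell J : ℝ) * Real.log 4 ≤ (3 * L) * 1.4 :=
      mul_le_mul hell hl4 (Real.log_nonneg (by norm_num)) (by linarith)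
    linarith
  have hX0 := Real.log_nonneg (Xb_ge β d J ⟨hβ0, hβ1⟩ hd)
  have hE : Eb ε β d J ≤ 132 * ε⁻¹ * (d * L^2) := by
    unfold Eb
    have : 4 * (d:ℝ) * ell J / ε * Real.log (4 ^ (ell J) * (2 * (d:ℝ) * (J+1) * (J+2) / β))
      ≤ 4 * (d:ℝ) * (3 * L) / ε * (11 * L) := by gcongr
    refine this.trans (le_of_eq ?_)
    rw [div_eq_mul_inv]; ring
  have hLL : L ≤ d * L^2 := by nlinarith
  have hR : Rb ε β T ≤ 16 * ε⁻¹ * (4 * (d * L^2) + log2c T) := by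
    unfold Rb
    rw [div_eq_mul_inv]
    gcongr
    rw [mul_div_assoc, div_eq_mul_one_div (T:ℝ), Real.log_mul (by norm_num) (by positivity),
      Real.log_mul (by positivity) (by positivity)]
    have h1 : Real.log (1/β) ≤ L := (Real.log_le_log (by positivity) hbz).trans hLz
    have h2 := log_le_log2c (T:ℝ) (by positivity)
    linarith
  have hi : 0 < ε⁻¹ := by positivity
  have h5 : 0 ≤ ε⁻¹ * (d * L^2) := by positivity
  have h6 : 0 ≤ ε⁻¹ * log2c T := by positivity
  nlinarith

/-! histogram -/
theorem HH_mono {d T : ℕ} (x : Fin T → Fin d → Bool) (i : Fin d) : Monotone (fun t => HH x t i) := by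
  intro s t hst
  unfold HH
  refine Finset.sum_le_sum (fun u _ => ?_)
  split_ifs with h1 h2 <;> first | omega | skip
  exact absurd ⟨h1.1.trans hst, h1.2⟩ h2

theorem HH_nonneg {d T : ℕ} (x : Fin T → Fin d → Bool) (t : ℕ) (i : Fin d) : 0 ≤ HH x t i := by
  unfold HH
  refine Finset.sum_nonneg (fun u _ => ?_)
  split_ifs <;> omega

theorem HH_causal {d T : ℕ} (x y : Fin T → Fin d → Bool) (t : ℕ)
    (h : ∀ s : Fin T, s.val ≤ t → x s = y s) : HH x t = HH y t := by
  funext i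
  unfold HH
  refine Finset.sum_congr rfl (fun u _ => ?_)
  by_cases hu : u.val ≤ t
  · rw [h u hu]
  · simp [hu]

theorem HH_neighbor {d T : ℕ} (x y : Fin T → Fin d → Bool) (t0 : Fin T)
    (h : ∀ s : Fin T, s ≠ t0 → x s = y s) (t : ℕ) (i : Fin d) :
    HH y t i = HH x t i - if t0.val ≤ t then
      ((if x t0 i then 1 else 0) - (if y t0 i then 1 else 0)) else 0 := by
  unfold HH
  rw [← Finset.add_sum_erase _ _ (Finset.mem_univ t0), ← Finset.add_sum_erase (a := t0)
    (f := fun s : Fin T => if s.val ≤ t ∧ x s i then (1:ℤ) else 0) _ (Finset.mem_univ t0)]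
  have : ∑ s ∈ Finset.univ.erase t0, (if s.val ≤ t ∧ y s i then (1:ℤ) else 0) =
      ∑ s ∈ Finset.univ.erase t0, (if s.val ≤ t ∧ x s i then (1:ℤ) else 0) := by
    refine Finset.sum_congr rfl (fun u hu => ?_)
    rw [h u (Finset.ne_of_mem_erase hu)]
  rw [this]
  by_cases ht : t0.val ≤ t
  · simp [ht]; ring
  · simp [ht]

theorem minSum_eq {d T : ℕ} (hd : 1 ≤ d) (x : Fin T → Fin d → Bool) (t : Fin T) :
    ((minSum x t : ℕ) : ℤ) = mn (HH x t.val) := by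
  have hh : ∀ i, ((hist x t i : ℕ) : ℤ) = HH x t.val i := by
    intro i
    unfold hist HH
    push_cast
    rfl
  have : Nonempty (Fin d) := ⟨⟨0, hd⟩⟩
  apply le_antisymm
  · obtain ⟨i, hi⟩ := mn_mem hd (HH x t.val)
    rw [← hi, ← hh]
    have : minSum x t ≤ hist x t i := Nat.sInf_le ⟨i, rfl⟩
    exact_mod_cast this
  · obtain ⟨i, hi⟩ := Nat.sInf_mem (Set.range_nonempty (fun i : Fin d => hist x t i))
    unfold minSum
    rw [← hi]
    dsimp only
    rw [hh]
    exact mn_le _ i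
abbrev Idx (T d : ℕ) := (Fin (T+1) ⊕ Fin (T+1)) ⊕ (Fin (T+1) × Fin d)

noncomputable def rate (ε : ℝ) (T d : ℕ) : Idx T d → ℝ
  | .inl _ => ε / 8
  | .inr (k, _) => ε / (2 * d * ell k.val)

def fr {T d : ℕ} (ω : Idx T d → ℤ) (j : ℕ) : ℤ := ω (.inl (.inl (Fin.ofNat (T+1) j)))
def fv {T d : ℕ} (ω : Idx T d → ℤ) (j : ℕ) : ℤ := ω (.inl (.inr (Fin.ofNat (T+1) j)))
def fZ {T d : ℕ} (ω : Idx T d → ℤ) (j : ℕ) (i : Fin d) : ℤ := ω (.inr (Fin.ofNat (T+1) j, i))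

noncomputable def mech {T d : ℕ} (K : ℕ → ℝ) (x : Fin T → Fin d → Bool) (ω : Idx T d → ℤ) (t : ℕ) :
    ℕ × ℤ := run K (HH x) (fr ω) (fv ω) (fZ ω) t

def shiftV {T d : ℕ} (J : ℕ → ℕ) (t0 : ℕ) (δ : Fin d → ℤ) : Idx T d → ℤ
  | .inl (.inl j) => if j.val = J t0 then 1 else 0
  | .inl (.inr t) => if t.val < T ∧ J t.val = J t0 ∧ J (t.val + 1) ≠ J t0 then 2 else 0
  | .inr (k, i) => if par k.val < J t0 + 1 ∧ J t0 + 1 ≤ k.val then δ i else 0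

theorem ofNat_val (T j : ℕ) (h : j ≤ T) : (Fin.ofNat (T+1) j).val = j := by
  simp [Fin.ofNat, Nat.mod_eq_of_lt (Nat.lt_succ_of_le h)]

theorem shift_cost {T d : ℕ} (ε : ℝ) (hε : 0 < ε) (hd : 1 ≤ d) (J : ℕ → ℕ) (hJ : Monotone J) (t0 : ℕ)
    (δ : Fin d → ℤ) (hδ : ∀ i, |δ i| ≤ 1) :
    ∑ k : Idx T d, rate ε T d k * |((shiftV J t0 δ k : ℤ) : ℝ)| ≤ ε := by
  have hd' : (1:ℝ) ≤ d := by exact_mod_cast hd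
  have hd0 : (0:ℝ) < d := by linarith
  rw [Fintype.sum_sum_type, Fintype.sum_sum_type, Fintype.sum_prod_type]
  have h1 : ∑ j : Fin (T+1), rate ε T d (.inl (.inl j)) *
      |((shiftV (d := d) J t0 δ (.inl (.inl j)) : ℤ) : ℝ)| ≤ ε / 8 := by
    have : ∀ j : Fin (T+1), rate ε T d (.inl (.inl j)) *
      |((shiftV (d := d) J t0 δ (.inl (.inl j)) : ℤ) : ℝ)| = if j.val = J t0 then ε/8 else 0 := by
      intro j
      simp only [rate, shiftV]
      split_ifs <;> simp
    simp_rw [this]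
    rw [← Finset.sum_filter, Finset.sum_const, nsmul_eq_mul]
    have hc : (Finset.univ.filter (fun j : Fin (T+1) => j.val = J t0)).card ≤ 1 := by
      rw [Finset.card_le_one]
      intro a ha b hb
      simp only [Finset.mem_filter] at ha hb
      exact Fin.ext (by omega)
    have : ((Finset.univ.filter (fun j : Fin (T+1) => j.val = J t0)).card : ℝ) ≤ 1 := by exact_mod_cast hc
    nlinarith
  have h2 : ∑ j : Fin (T+1), rate ε T d (.inl (.inr j)) *
      |((shiftV (d := d) J t0 δ (.inl (.inr j)) : ℤ) : ℝ)| ≤ ε / 4 := by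
    have : ∀ j : Fin (T+1), rate ε T d (.inl (.inr j)) *
      |((shiftV (d := d) J t0 δ (.inl (.inr j)) : ℤ) : ℝ)| =
        if j.val < T ∧ J j.val = J t0 ∧ J (j.val + 1) ≠ J t0 then ε/4 else 0 := by
      intro j
      simp only [rate, shiftV]
      split_ifs
      · simp; ring
      · simp
    simp_rw [this]
    rw [← Finset.sum_filter, Finset.sum_const, nsmul_eq_mul]
    have hc : (Finset.univ.filter (fun j : Fin (T+1) =>
        j.val < T ∧ J j.val = J t0 ∧ J (j.val + 1) ≠ J t0)).card ≤ 1 := by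
      rw [Finset.card_le_one]
      intro a ha b hb
      simp only [Finset.mem_filter] at ha hb
      rcases lt_trichotomy a.val b.val with h | h | h
      · have h1 : J (a.val+1) ≤ J b.val := hJ h
        have h2 : J a.val ≤ J (a.val+1) := hJ (by omega)
        omega
      · exact Fin.ext h
      · have h1 : J (b.val+1) ≤ J a.val := hJ h
        have h2 : J b.val ≤ J (b.val+1) := hJ (by omega)
        omega
    have : ((Finset.univ.filter (fun j : Fin (T+1) =>
        j.val < T ∧ J j.val = J t0 ∧ J (j.val + 1) ≠ J t0)).card : ℝ) ≤ 1 := by exact_mod_cast hc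
    nlinarith
  have h3 : ∑ k : Fin (T+1), ∑ i : Fin d, rate ε T d (.inr (k, i)) *
      |((shiftV J t0 δ (.inr (k, i)) : ℤ) : ℝ)| ≤ ε / 2 := by
    set i0 := J t0 + 1 with hi0
    have hl0 : (0:ℝ) < ell i0 := by unfold ell; positivity
    have : ∀ k : Fin (T+1), ∑ i : Fin d, rate ε T d (.inr (k, i)) *
      |((shiftV J t0 δ (.inr (k, i)) : ℤ) : ℝ)| ≤
        if par k.val < i0 ∧ i0 ≤ k.val then ε / (2 * ell i0) else 0 := by
      intro k
      simp only [rate, shiftV]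
      rw [← hi0]
      split_ifs with hk
      · have hle : (ell i0 : ℝ) ≤ ell k.val := by exact_mod_cast ell_mono hk.2
        calc ∑ i : Fin d, ε / (2 * d * ell k.val) * |(δ i : ℝ)|
            ≤ ∑ i : Fin d, ε / (2 * d * ell i0) * 1 := by
              refine Finset.sum_le_sum (fun i _ => ?_)
              have : |(δ i : ℝ)| ≤ 1 := by exact_mod_cast hδ i
              gcongr
          _ = ε / (2 * ell i0) := by
              simp; field_simp
      · simp
    refine (Finset.sum_le_sum (fun k _ => this k)).trans ?_
    rw [← Finset.sum_filter, Finset.sum_const, nsmul_eq_mul]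
    have hc : (Finset.univ.filter (fun k : Fin (T+1) => par k.val < i0 ∧ i0 ≤ k.val)).card ≤ ell i0 := by
      refine le_trans ?_ (cover_card (T+1) i0 (by omega))
      rw [← Finset.card_map Fin.valEmbedding]
      refine Finset.card_le_card ?_
      intro m hm
      simp only [Finset.mem_map, Finset.mem_filter] at hm ⊢
      obtain ⟨k, ⟨_, hk⟩, rfl⟩ := hm
      exact ⟨Finset.mem_range.2 k.2, hk⟩
    have hc' : ((Finset.univ.filter (fun k : Fin (T+1) => par k.val < i0 ∧ i0 ≤ k.val)).card : ℝ)
      ≤ ell i0 := by exact_mod_cast hc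
    calc _ ≤ (ell i0 : ℝ) * (ε / (2 * ell i0)) := by gcongr
      _ = ε / 2 := by field_simp
  linarith

theorem mech_couple {T d : ℕ} (K : ℕ → ℝ) (hd : 1 ≤ d) (x y : Fin T → Fin d → Bool) (t0 : Fin T)
    (h : ∀ s : Fin T, s ≠ t0 → x s = y s) (δ : Fin d → ℤ)
    (hδ : ∀ i, δ i = (if x t0 i then 1 else 0) - (if y t0 i then 1 else 0))
    (ω : Idx T d → ℤ) (t : ℕ) (ht : t ≤ T) :
    mech K y (ω + shiftV (fun s => (mech K x ω s).1) t0.val δ) t = mech K x ω t := by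
  refine run_couple K (HH x) (fr ω) (fv ω) (fZ ω) hd T t0.val (HH y) _ _ _ δ ?_ ?_ ?_ ?_ ?_ t ht
  · intro i; rw [hδ]; split_ifs <;> simp
  · intro t i; rw [HH_neighbor x y t0 h, hδ]
  · intro j hj
    simp only [fr, Pi.add_apply, shiftV, ofNat_val T j hj]; rfl
  · intro j hj
    simp only [fv, Pi.add_apply, shiftV, ofNat_val T j hj.le, hj, true_and]; rfl
  · intro j hj i
    simp only [fZ, Pi.add_apply, shiftV, ofNat_val T j hj]; rfl

theorem mech_dp {T d : ℕ} (K : ℕ → ℝ) (ε : ℝ) (hε : 0 < ε) (hd : 1 ≤ d) (μ : Measure (Idx T d → ℤ))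
    (hμ : ∀ ω v : Idx T d → ℤ, μ {ω} ≤
      ENNReal.ofReal (Real.exp (∑ i, rate ε T d i * |(v i : ℝ)|)) * μ {ω + v}) :
    IsEventDP ε (fun x => μ.map (fun ω (t : Fin T) => (((mech K x ω (t.val+1)).2 : ℤ) : ℝ))) := by
  intro x y hxy S hS
  obtain ⟨t0, h⟩ := hxy
  set δ : Fin d → ℤ := fun i => (if x t0 i then 1 else 0) - (if y t0 i then 1 else 0) with hδ
  have hδ1 : ∀ i, |δ i| ≤ 1 := by intro i; rw [hδ]; dsimp only; split_ifs <;> simp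
  have hcp := mech_couple K hd x y t0 h δ (fun i => rfl)
  have hJm : ∀ ω, Monotone (fun s => (mech K x ω s).1) := fun ω => run_mono _ _ _ _ _
  have hcongr : ∀ ω ω' : Idx T d → ℤ, (∀ t ≤ T, (mech K x ω t).1 = (mech K x ω' t).1) →
      shiftV (T := T) (fun s => (mech K x ω s).1) t0.val δ =
      shiftV (T := T) (fun s => (mech K x ω' s).1) t0.val δ := by
    intro ω ω' hh
    funext k
    rcases k with (j | t) | ⟨k, i⟩
    · simp only [shiftV, hh t0.val t0.2.le]
    · by_cases ht : t.val < T
      · simp only [shiftV, hh t0.val t0.2.le, hh t.val (by omega), hh (t.val+1) (by omega)]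
      · simp only [shiftV, ht, false_and]
    · simp only [shiftV, hh t0.val t0.2.le]
  refine dp_of_coupling μ _ _
    (fun ω => ω + shiftV (fun s => (mech K x ω s).1) t0.val δ) ?_ ?_ _ ?_ S hS
  · intro ω ω' he
    dsimp only at he
    have : ∀ t ≤ T, (mech K x ω t).1 = (mech K x ω' t).1 := by
      intro t ht
      rw [← hcp ω t ht, he, hcp ω' t ht]
    rw [hcongr ω ω' this] at he
    exact add_right_cancel he
  · intro ω
    funext t
    rw [hcp ω (t.val+1) t.2]
  · intro ω
    refine (hμ ω (shiftV (fun s => (mech K x ω s).1) t0.val δ)).trans ?_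
    gcongr
    exact shift_cost ε hε hd _ (hJm ω) _ δ hδ1

theorem mech_co {T d : ℕ} (K : ℕ → ℝ) (μ : Measure (Idx T d → ℤ)) [IsProbabilityMeasure μ] :
    IsCOMech (fun x : Fin T → Fin d → Bool =>
      μ.map (fun ω (t : Fin T) => (((mech K x ω (t.val+1)).2 : ℤ) : ℝ))) := by
  refine ⟨measurable_of_finite _, fun x => Measure.isProbabilityMeasure_map
    (measurable_of_countable _).aemeasurable, ?_⟩
  intro t x y hxy
  have hm : Measurable (fun (a : Fin T → ℝ) (s : {s : Fin T // s ≤ t}) => a s.1) :=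
    measurable_pi_lambda _ (fun s => measurable_pi_apply _)
  dsimp only
  rw [Measure.map_map hm (measurable_of_countable _), Measure.map_map hm (measurable_of_countable _)]
  congr 1
  funext ω s
  simp only [Function.comp]
  unfold mech
  rw [run_causal K (HH x) (fr ω) (fv ω) (fZ ω) (HH y)]
  intro u hu
  refine HH_causal x y u (fun w hw => hxy w ?_)
  have h1 : s.1.val ≤ t.val := s.2
  exact Fin.le_def.2 (by omega)

/-- the bad-event sets -/
def evS (T d : ℕ) : Idx T d → Finset (Idx T d)
  | .inl u => {.inl u}
  | .inr (J, i) => (chain J.val).image (fun k => .inr (Fin.ofNat (T+1) k, i))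

noncomputable def evC (ε β : ℝ) (T d : ℕ) : Idx T d → ℝ
  | .inl _ => Rb ε β T
  | .inr (J, _) => Eb ε β d J.val

noncomputable def evB (β : ℝ) (T d : ℕ) : Idx T d → ℝ
  | .inl _ => β / (8 * T)
  | .inr (J, _) => β / (2 * d * (J.val+1) * (J.val+2))

theorem tele (n : ℕ) : ∑ j ∈ Finset.range n, (1:ℝ) / ((j+1) * (j+2)) ≤ 1 - 1 / (n+1) := by
  induction n with
  | zero => simp
  | succ n ih =>
    rw [Finset.sum_range_succ]
    have : (1:ℝ) / ((n+1) * (n+2)) = 1/(n+1) - 1/(n+2) := by field_simp; ring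
    have e : (((n+1 : ℕ) : ℝ) + 1) = n + 2 := by push_cast; ring
    rw [this, e]; linarith

theorem evB_sum (β : ℝ) (T d : ℕ) (hβ : 0 < β) (hd : 1 ≤ d) (hT : 1 ≤ T) :
    ∑ e, evB β T d e ≤ β := by
  have hT' : (1:ℝ) ≤ T := by exact_mod_cast hT
  have hd' : (1:ℝ) ≤ d := by exact_mod_cast hd
  have hd0 : (0:ℝ) < d := by linarith
  rw [Fintype.sum_sum_type, Fintype.sum_prod_type]
  have h1 : ∑ u : Fin (T+1) ⊕ Fin (T+1), evB β T d (.inl u) ≤ β / 2 := by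
    simp only [evB, Finset.sum_const, nsmul_eq_mul, Finset.card_univ, Fintype.card_sum, Fintype.card_fin]
    push_cast
    rw [← mul_div_assoc, div_le_div_iff₀ (by positivity) (by norm_num)]
    nlinarith
  have h2 : ∑ J : Fin (T+1), ∑ i : Fin d, evB β T d (.inr (J, i)) ≤ β / 2 := by
    have : ∀ J : Fin (T+1), ∑ i : Fin d, evB β T d (.inr (J, i)) =
        β / 2 * (1 / (((J.val:ℝ)+1) * (J.val+2))) := by
      intro J
      simp only [evB, Finset.sum_const, nsmul_eq_mul, Finset.card_univ, Fintype.card_fin]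
      field_simp
    simp_rw [this]
    rw [← Finset.mul_sum, Fin.sum_univ_eq_sum_range (fun j : ℕ => (1:ℝ) / ((j+1) * (j+2))) (T+1)]
    have h3 := tele (T+1)
    have h4 : (0:ℝ) ≤ 1 / (((T+1:ℕ):ℝ)+1) := by positivity
    nlinarith
  linarith

theorem evP {T d : ℕ} (ε β : ℝ) (hε : 0 < ε) (hβ : β ∈ Set.Ioo (0:ℝ) 1) (hd : 1 ≤ d) (hT : 1 ≤ T)
    (μ : Measure (Idx T d → ℤ))
    (hμ : ∀ (s : Finset (Idx T d)) (θ c : ℝ), 0 ≤ θ → (∀ i ∈ s, θ ≤ rate ε T d i / 2) →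
        μ {ω | c < ∑ i ∈ s, |(ω i : ℝ)|} ≤ ENNReal.ofReal (2 ^ s.card * Real.exp (-(θ * c))))
    (e : Idx T d) :
    μ {ω | evC ε β T d e < ∑ k ∈ evS T d e, |(ω k : ℝ)|} ≤ ENNReal.ofReal (evB β T d e) := by
  have hT' : (1:ℝ) ≤ T := by exact_mod_cast hT
  have hd' : (1:ℝ) ≤ d := by exact_mod_cast hd
  have hd0 : (0:ℝ) < d := by linarith
  have hβ0 := hβ.1
  rcases e with u | ⟨J, i⟩
  · refine (hμ (evS T d (.inl u)) (ε/16) _ (by positivity) ?_).trans ?_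
    · intro k hk
      simp only [evS, Finset.mem_singleton] at hk
      subst hk
      simp only [rate]; linarith
    · apply ENNReal.ofReal_le_ofReal
      simp only [evS, evC, evB, Finset.card_singleton, Rb]
      have : ε / 16 * (16 / ε * Real.log (16 * T / β)) = Real.log (16 * T / β) := by
        field_simp
      rw [this, Real.exp_neg, Real.exp_log (by positivity)]
      apply le_of_eq
      field_simp
      norm_num
  · have hl0 : (0:ℝ) < ell J.val := by unfold ell; positivity
    refine (hμ (evS T d (.inr (J, i))) (ε/(4 * d * ell J.val)) _ (by positivity) ?_).trans ?_
    · intro k hk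
      simp only [evS, Finset.mem_image] at hk
      obtain ⟨m, hm, rfl⟩ := hk
      have hm' := chain_mem _ _ hm
      have hJ := J.2
      simp only [rate]
      rw [ofNat_val T m (by omega)]
      have : (ell m : ℝ) ≤ ell J.val := by exact_mod_cast ell_mono hm'.2
      have hm0 : (0:ℝ) < ell m := by unfold ell; positivity
      rw [div_div]
      apply div_le_div_of_nonneg_left hε.le (by positivity)
      nlinarith
    · apply ENNReal.ofReal_le_ofReal
      have hcard : (evS T d (.inr (J, i))).card ≤ 2 * ell J.val := by
        simp only [evS]
        exact Finset.card_image_le.trans (chain_card _)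
      simp only [evC, evB, Eb]
      have hX := Xb_ge β d J.val hβ hd
      have : ε / (4 * d * ell J.val) * (4 * d * ell J.val / ε *
        Real.log (4 ^ ell J.val * (2 * d * (J.val+1) * (J.val+2) / β))) =
        Real.log (4 ^ ell J.val * (2 * d * (J.val+1) * (J.val+2) / β)) := by
        field_simp
      rw [this, Real.exp_neg, Real.exp_log (by linarith)]
      have h4 : (2:ℝ) ^ (evS T d (.inr (J, i))).card ≤ 4 ^ ell J.val := by
        refine (pow_le_pow_right₀ (by norm_num) hcard).trans (le_of_eq ?_)
        rw [pow_mul]; norm_num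
      calc _ ≤ (4:ℝ) ^ ell J.val * (4 ^ ell J.val * (2 * d * (J.val+1) * (J.val+2) / β))⁻¹ := by
            gcongr
        _ = _ := by field_simp

theorem good_prob {T d : ℕ} (ε β : ℝ) (hε : 0 < ε) (hβ : β ∈ Set.Ioo (0:ℝ) 1) (hd : 1 ≤ d) (hT : 1 ≤ T)
    (μ : Measure (Idx T d → ℤ)) [IsProbabilityMeasure μ]
    (hμ : ∀ (s : Finset (Idx T d)) (θ c : ℝ), 0 ≤ θ → (∀ i ∈ s, θ ≤ rate ε T d i / 2) →
        μ {ω | c < ∑ i ∈ s, |(ω i : ℝ)|} ≤ ENNReal.ofReal (2 ^ s.card * Real.exp (-(θ * c)))) :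
    ENNReal.ofReal (1 - β) ≤ μ {ω | ∀ e, ∑ k ∈ evS T d e, |(ω k : ℝ)| ≤ evC ε β T d e} := by
  set G := {ω : Idx T d → ℤ | ∀ e, ∑ k ∈ evS T d e, |(ω k : ℝ)| ≤ evC ε β T d e} with hG
  have hbad : μ Gᶜ ≤ ENNReal.ofReal β := by
    have hsub : Gᶜ ⊆ ⋃ e, {ω : Idx T d → ℤ | evC ε β T d e < ∑ k ∈ evS T d e, |(ω k : ℝ)|} := by
      intro ω hω
      have hω' : ¬ ∀ e, ∑ k ∈ evS T d e, |(ω k : ℝ)| ≤ evC ε β T d e := hω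
      push Not at hω'
      exact Set.mem_iUnion.2 hω'
    refine (measure_mono hsub).trans ((measure_iUnion_fintype_le _ _).trans ?_)
    refine (Finset.sum_le_sum (fun e _ => evP ε β hε hβ hd hT μ hμ e)).trans ?_
    rw [← ENNReal.ofReal_sum_of_nonneg]
    · exact ENNReal.ofReal_le_ofReal (evB_sum β T d hβ.1 hd hT)
    · intro e _
      have := hβ.1
      rcases e with u | ⟨J, i⟩ <;> simp only [evB] <;> positivity
  have h1 : (1:ENNReal) ≤ μ G + μ Gᶜ := by
    rw [← measure_univ (μ := μ), ← Set.union_compl_self G]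
    exact measure_union_le _ _
  rw [ENNReal.ofReal_sub _ hβ.1.le, ENNReal.ofReal_one]
  exact tsub_le_iff_right.2 (h1.trans (by gcongr))

theorem mech_acc {T d : ℕ} (ε β : ℝ) (hε : 0 < ε) (hβ : β ∈ Set.Ioo (0:ℝ) 1) (hd : 1 ≤ d) (hT : 1 ≤ T)
    (x : Fin T → Fin d → Bool) (ω : Idx T d → ℤ)
    (hω : ∀ e, ∑ k ∈ evS T d e, |(ω k : ℝ)| ≤ evC ε β T d e) (t : Fin T) :
    |(((mech (fun J => 3 * Eb ε β d J + 3 * Rb ε β T) x ω (t.val+1)).2 : ℤ) : ℝ) - (minSum x t : ℝ)| ≤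
                1000 * ε⁻¹ * ((d : ℝ) *
                    (log2c ((d : ℝ) * (minSum x (lastIdx T hT) : ℝ) / β)) ^ 2
                  + log2c (T : ℝ)) := by
  have hacc := run_acc (fun J => 3 * Eb ε β d J + 3 * Rb ε β T) (HH x) (fr ω) (fv ω) (fZ ω) hd T
    (Eb ε β d) (Rb ε β T) (Rb_pos ε β T hε hβ hT) (fun J => Eb_nonneg ε β d J hε hβ hd) (fun _ => rfl)
    (HH_nonneg x 0) (HH_mono x) ?_ ?_ ?_ t.val t.2
  · obtain ⟨a1, a2, a3⟩ := hacc
    change ((mech (fun J => 3 * Eb ε β d J + 3 * Rb ε β T) x ω (t.val+1)).1 : ℤ) ≤ _ at a1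
    change (mech (fun J => 3 * Eb ε β d J + 3 * Rb ε β T) x ω (t.val+1)).1 = 0 →
      (mech (fun J => 3 * Eb ε β d J + 3 * Rb ε β T) x ω (t.val+1)).2 = 0 at a2
    change |(((mech (fun J => 3 * Eb ε β d J + 3 * Rb ε β T) x ω (t.val+1)).2 : ℤ) : ℝ) - _| ≤
      4 * Eb ε β d (mech (fun J => 3 * Eb ε β d J + 3 * Rb ε β T) x ω (t.val+1)).1 + _ at a3
    generalize mech (fun J => 3 * Eb ε β d J + 3 * Rb ε β T) x ω (t.val+1) = st at a1 a2 a3 ⊢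
    rw [← minSum_eq hd] at a1 a3
    have hle : minSum x t ≤ minSum x (lastIdx T hT) := by
      have : ((minSum x t : ℕ) : ℤ) ≤ (minSum x (lastIdx T hT) : ℕ) := by
        rw [minSum_eq hd, minSum_eq hd]
        obtain ⟨i, hi⟩ := mn_mem hd (HH x (lastIdx T hT).val)
        rw [← hi]
        refine (mn_le _ i).trans (HH_mono x i ?_)
        have := t.2
        simp only [lastIdx]; omega
      exact_mod_cast this
    have ha1 : st.1 ≤ minSum x t := by exact_mod_cast a1
    by_cases hn : minSum x (lastIdx T hT) = 0
    · have h0 : minSum x t = 0 := by omega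
      rw [a2 (by omega), h0]
      have := log2c_ge_one (T:ℝ)
      simp only [Int.cast_zero, Nat.cast_zero, sub_self, abs_zero]
      positivity
    · refine le_trans ?_ (final_bound ε β d T _ st.1 hε hβ hd hT (by omega : 1 ≤ minSum x (lastIdx T hT))
        (by omega))
      exact_mod_cast a3
  · intro j _
    have := hω (.inl (.inl (Fin.ofNat (T+1) j)))
    simpa only [fr, fv, evS, evC, Finset.sum_singleton] using this
  · intro j _
    have := hω (.inl (.inr (Fin.ofNat (T+1) j)))
    simpa only [fr, fv, evS, evC, Finset.sum_singleton] using this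
  · intro J hJ i
    have := hω (.inr (Fin.ofNat (T+1) J, i))
    simp only [evS, evC, ofNat_val T J hJ] at this
    rw [Finset.sum_image] at this
    · push_cast
      exact (Finset.abs_sum_le_sum_abs _ _).trans this
    · intro a ha b hb hab
      have h1 := (chain_mem _ _ ha).2
      have h2 := (chain_mem _ _ hb).2
      simp only [Sum.inr.injEq, Prod.mk.injEq, and_true] at hab
      have := congrArg Fin.val hab
      rwa [ofNat_val T a (by omega), ofNat_val T b (by omega)] at this

theorem minsum_continual_observation :
    ∃ C : ℝ, 0 < C ∧
      ∀ (ε β : ℝ) (d T : ℕ) (_hε : 0 < ε) (_hβ : β ∈ Set.Ioo (0 : ℝ) 1)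
        (_hd : 1 ≤ d) (hT : 1 ≤ T),
        ∃ M : (Fin T → Fin d → Bool) → Measure (Fin T → ℝ),
          IsCOMech M ∧ IsEventDP ε M ∧
          ∀ x, ENNReal.ofReal (1 - β) ≤
            M x {a | ∀ t : Fin T,
              |a t - (minSum x t : ℝ)| ≤
                C * ε⁻¹ * ((d : ℝ) *
                    (log2c ((d : ℝ) * (minSum x (lastIdx T hT) : ℝ) / β)) ^ 2
                  + log2c (T : ℝ))} := by
  refine ⟨1000, by norm_num, ?_⟩
  intro ε β d T hε hβ hd hT
  have hr : ∀ i, 0 < rate ε T d i := by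
    intro i
    have hd0 : (0:ℝ) < d := by exact_mod_cast hd
    rcases i with u | ⟨J, i⟩ <;> simp only [rate, ell] <;> positivity
  obtain ⟨μ, hμ1, hμ2, hμ3⟩ := exists_noise (rate ε T d) hr
  refine ⟨_, mech_co (fun J => 3 * Eb ε β d J + 3 * Rb ε β T) μ, mech_dp _ ε hε hd μ hμ2, ?_⟩
  intro x
  refine (good_prob ε β hε hβ hd hT μ hμ3).trans ?_
  refine le_trans (measure_mono ?_) (Measure.le_map_apply (measurable_of_countable _).aemeasurable _)
  intro ω hω t
  exact mech_acc ε β hε hβ hd hT x ω hω t
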